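/- Let k ≥ 3 and let p = p_1 ⋯ p_n be a permutation avoiding A_{k,k}. If j is the smallest index such that the rank of p_j is at least k-1 (assuming such an index exists), then the suffix p_j, p_{j+1}, …, p_n is increasing: p_j < p_{j+1} < ⋯ < p_n. -/

import Mathlib

/-- A permutation `p` of length `n` contains the pattern `q` of length `k` if there
are positions `i₁ < i₂ < ⋯ < i_k` whose entries are order-isomorphic to `q`. -/
def Contains {n k : ℕ} (p : Equiv.Perm (Fin n)) (q : Equiv.Perm (Fin k)) : Prop :=
  ∃ f : Fin k → Fin n, StrictMono f ∧ ∀ r s : Fin k, q r < q s ↔ p (f r) < p (f s)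

/-- `p` avoids every pattern in the set `S` of patterns of length `k`. -/
def AvoidsSet {n k : ℕ} (p : Equiv.Perm (Fin n)) (S : Set (Equiv.Perm (Fin k))) : Prop :=
  ∀ q ∈ S, ¬ Contains p q

/-- `A_k`: the set of patterns of length `k` whose first `k-1` entries are increasing. -/
def Ak (k : ℕ) : Set (Equiv.Perm (Fin k)) :=
  { q | ∀ r s : Fin k, (r : ℕ) < (s : ℕ) → (s : ℕ) < k - 1 → q r < q s }

/-- `A_{k,i}`: the set `A_k` with the pattern ending in `i` removed (entries of patterns
are thought of as `1`-indexed values `1,…,k`, so value `i` corresponds to `i-1 : Fin k`). -/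
def Aki (k i : ℕ) : Set (Equiv.Perm (Fin k)) :=
  { q ∈ Ak k | ∀ j : Fin k, (j : ℕ) = k - 1 → (q j : ℕ) ≠ i - 1 }

/-- The number of permutations of length `n` avoiding the set of patterns `S`. -/
noncomputable def avSet (n : ℕ) {k : ℕ} (S : Set (Equiv.Perm (Fin k))) : ℕ :=
  Nat.card { p : Equiv.Perm (Fin n) // AvoidsSet p S }

/-- The number of permutations of length `n` avoiding the single pattern `q`. -/
noncomputable def avPat (n : ℕ) {k : ℕ} (q : Equiv.Perm (Fin k)) : ℕ :=
  Nat.card { p : Equiv.Perm (Fin n) // ¬ Contains p q }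

/-- The rank of the entry in position `j` of `p`: the length of the longest increasing
subsequence of `p` ending in `p j`. -/
noncomputable def rank {n : ℕ} (p : Equiv.Perm (Fin n)) (j : Fin n) : ℕ :=
  sSup { m : ℕ | ∃ f : Fin m → Fin n, StrictMono f ∧ StrictMono (p ∘ f) ∧
    (∀ r, f r ≤ j) ∧ (∃ r, f r = j) }

/-- Standardization of an injective sequence. -/
theorem exists_std {n k : ℕ} (v : Fin k → Fin n) (hv : Function.Injective v) :
    ∃ q : Equiv.Perm (Fin k), ∀ r s, q r < q s ↔ v r < v s := by
  classical
  have hc : (Finset.univ.image v).card = k := by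
    rw [Finset.card_image_of_injective _ hv]; simp
  let o := (Finset.univ.image v).orderIsoOfFin hc
  let w : Fin k → (Finset.univ.image v) := fun r => ⟨v r, by simp⟩
  have hi : Function.Injective (fun r => o.symm (w r)) := by
    intro r s hrs
    have h1 := o.symm.injective hrs
    exact hv (congrArg Subtype.val h1)
  refine ⟨Equiv.ofBijective _ (Finite.injective_iff_bijective.mp hi), fun r s => ?_⟩
  rw [Equiv.ofBijective_apply, Equiv.ofBijective_apply, OrderIso.lt_iff_lt]
  exact Iff.rfl

/-- Any entry after an increasing subsequence of length `k-1` is larger than its last entry. -/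
theorem key {n d : ℕ} (p : Equiv.Perm (Fin n)) (hp : AvoidsSet p (Aki (d + 2) (d + 2)))
    (h : Fin (d + 1) → Fin n) (hm : StrictMono h) (hpm : StrictMono (fun r => p (h r)))
    (m : Fin n) (hlm : h (Fin.last d) < m) : p (h (Fin.last d)) < p m := by
  by_contra hcon
  let g : Fin (d + 2) → Fin n := Fin.snoc h m
  have gc : ∀ r : Fin (d + 1), g r.castSucc = h r := fun r => by simp [g]
  have gl : g (Fin.last (d + 1)) = m := by simp [g]
  have hg : StrictMono g := by
    intro r s hrs
    induction r using Fin.lastCases with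
    | last => exact absurd hrs (not_lt.mpr (Fin.le_last s))
    | cast r =>
      induction s using Fin.lastCases with
      | last => rw [gc, gl]; exact lt_of_le_of_lt (hm.monotone (Fin.le_last r)) hlm
      | cast s => rw [gc, gc]; exact hm (by simpa using hrs)
  obtain ⟨q, hq⟩ := exists_std (fun r => p (g r)) (p.injective.comp hg.injective)
  refine hp q ⟨?_, ?_⟩ ⟨g, hg, hq⟩
  · intro r s hrs hs
    rw [hq]
    obtain ⟨sa, rfl⟩ : ∃ sa, s = Fin.castSucc sa := ⟨⟨s, by omega⟩, rfl⟩
    obtain ⟨ra, rfl⟩ : ∃ ra, r = Fin.castSucc ra :=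
      ⟨⟨r, by have := sa.isLt; simp at hrs; omega⟩, rfl⟩
    simp only [gc]
    exact hpm (by simpa using hrs)
  · intro i hi hqi
    have hil : i = Fin.last (d + 1) := Fin.ext (by simpa using hi)
    have hlt : p m < p (h (Fin.last d)) :=
      lt_of_le_of_ne (not_lt.mp hcon) (fun e => hlm.ne (p.injective e).symm)
    have h3 : q (Fin.last (d + 1)) < q (Fin.last d).castSucc := by
      rw [hq]; simpa only [gc, gl] using hlt
    rw [← hil] at h3
    have h4 := (q (Fin.last d).castSucc).isLt
    have h5 := Fin.lt_def.mp h3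
    omega

/-- An entry of rank at least `d+1` ends an increasing subsequence of length `d+1`. -/
theorem exists_of_rank {n : ℕ} (p : Equiv.Perm (Fin n)) (j : Fin n) (d : ℕ)
    (hj : d + 1 ≤ rank p j) : ∃ h : Fin (d + 1) → Fin n, StrictMono h ∧
      StrictMono (fun r => p (h r)) ∧ h (Fin.last d) = j := by
  have hmem := Nat.sSup_mem (s := { m : ℕ | ∃ f : Fin m → Fin n, StrictMono f ∧
    StrictMono (p ∘ f) ∧ (∀ r, f r ≤ j) ∧ (∃ r, f r = j) }) ?_ ?_
  · change rank p j ∈ _ at hmem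
    generalize rank p j = M at hj hmem
    obtain ⟨f, hf, hpf, hle, r₀, hr₀⟩ := hmem
    let e : Fin (d + 1) → Fin M := fun r => ⟨r + (M - (d + 1)), by omega⟩
    have he : StrictMono e := by
      intro r s hrs
      have := Fin.lt_def.mp hrs
      rw [Fin.lt_def]
      simp only [e]
      omega
    refine ⟨f ∘ e, hf.comp he, hpf.comp he, le_antisymm (hle _) ?_⟩
    have : f r₀ ≤ f (e (Fin.last d)) := by
      apply hf.monotone
      rw [Fin.le_def]
      simp only [e, Fin.val_last]
      omega
    rwa [hr₀] at this
  · exact ⟨1, fun _ => j, Subsingleton.strictMono _, Subsingleton.strictMono _,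
      fun _ => le_rfl, 0, rfl⟩
  · refine ⟨n, ?_⟩
    rintro m ⟨f, hf, -⟩
    simpa using Fintype.card_le_of_injective f hf.injective

/-- If `p` avoids `A_{k,k}` and `j` is the smallest position of rank at least `k-1`,
then the suffix starting at position `j` is increasing. -/
theorem stmt10 (k n : ℕ) (hk : 3 ≤ k) (p : Equiv.Perm (Fin n))
    (hp : AvoidsSet p (Aki k k)) (j : Fin n)
    (hj : k - 1 ≤ rank p j) (hmin : ∀ m : Fin n, m < j → rank p m < k - 1) :
    ∀ m₁ m₂ : Fin n, j ≤ m₁ → m₁ < m₂ → p m₁ < p m₂ := by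
  obtain ⟨d, rfl⟩ : ∃ d, k = d + 2 := ⟨k - 2, by omega⟩
  obtain ⟨h, hm, hpm, hl⟩ := exists_of_rank p j d (by simpa using hj)
  intro m₁ m₂ h1 h2
  rcases h1.eq_or_lt with rfl | h1
  · have := key p hp h hm hpm m₂ (by rw [hl]; exact h2)
    rwa [hl] at this
  · have hj1 : p j < p m₁ := by
      have := key p hp h hm hpm m₁ (by rw [hl]; exact h1)
      rwa [hl] at this
    have hle : ∀ r, h r ≤ j := fun r => hl ▸ hm.monotone (Fin.le_last r)
    have hple : ∀ r, p (h r) ≤ p j := fun r => hl ▸ hpm.monotone (Fin.le_last r)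
    have aux := key p hp (fun r => if r = Fin.last d then m₁ else h r) ?_ ?_ m₂ (by simpa using h2)
    · simpa using aux
    · intro r s hrs
      have hr : r ≠ Fin.last d := (lt_of_lt_of_le hrs (Fin.le_last s)).ne
      by_cases hs : s = Fin.last d
      · simpa [hr, hs] using lt_of_le_of_lt (hle r) h1
      · simpa [hr, hs] using hm hrs
    · intro r s hrs
      have hr : r ≠ Fin.last d := (lt_of_lt_of_le hrs (Fin.le_last s)).ne
      by_cases hs : s = Fin.last d
      · simpa [hr, hs] using lt_of_le_of_lt (hple r) hj1
      · simpa [hr, hs] using hpm hrs
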